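/- arXiv:math/0406114 — 2 statements merged into one kernel-verified Lean document; each statement's English description precedes it below -/
import Mathlib

section
/- Conformal invariance of the mirror distortion: Let ψ₁,ψ₂:𝔻→𝔻 be holomorphic maps without critical points and let Ψ=(ψ₁,ψ₂) with mirror conformal derivative DΨ². Let R̂₁=(R₁,R̄₁) and R̂₂=(R₂,R̄₂) be mirror automorphisms of 𝔻², and set Φ=(R₂∘ψ₁∘R₁, R̄₂∘ψ₂∘R̄₁) with mirror conformal derivative DΦ². Then for all (u₁,u₂)∈𝔻², writing (z₁,z₂)=(R₁(u₁),R̄₁(u₂)): (1−|z₁|²)·|∂_{z₁}DΨ²(z₁,z₂)/DΨ²(z₁,z₂)| = (1−|u₁|²)·|∂_{u₁}DΦ²(u₁,u₂)/DΦ²(u₁,u₂)|, and the analogous identity holds in the second variable. -/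
open Complex Metric

noncomputable section

/-- the mirror conformal derivative `DΨ²` of the product map `Ψ = (ψ₁,ψ₂)` on `𝔻²`:
`DΨ²(z₁,z₂) = ψ₁'(z₁)·ψ₂'(z₂)·(1−z₁z₂)²/(1−ψ₁(z₁)ψ₂(z₂))²`. -/
def mirrorDsq (ψ₁ ψ₂ : ℂ → ℂ) (z₁ z₂ : ℂ) : ℂ :=
  deriv ψ₁ z₁ * deriv ψ₂ z₂ * (1 - z₁ * z₂) ^ 2 / (1 - ψ₁ z₁ * ψ₂ z₂) ^ 2

open scoped ComplexConjugate

/-- The Möbius map `z ↦ (az + b) / (b̄z + ā)`; its mirror image is `diskMobius ā b̄`. -/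
def diskMobius (a b z : ℂ) : ℂ := (a * z + b) / (conj b * z + conj a)

lemma diskMobius_denom_ne_zero {a b z : ℂ} (h : ‖b‖ < ‖a‖) (hz : ‖z‖ < 1) :
    conj b * z + conj a ≠ 0 := by
  intro h0
  have hn : ‖conj b * z‖ = ‖conj a‖ := by rw [eq_neg_of_add_eq_zero_left h0, norm_neg]
  rw [norm_mul, RCLike.norm_conj, RCLike.norm_conj] at hn
  nlinarith [norm_nonneg b]

lemma hasDerivAt_diskMobius {a b z : ℂ} (h : ‖b‖ < ‖a‖) (hz : ‖z‖ < 1) :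
    HasDerivAt (diskMobius a b)
      ((a * conj a - b * conj b) / (conj b * z + conj a) ^ 2) z := by
  have hnum : HasDerivAt (fun z => a * z + b) a z := by
    simpa using ((hasDerivAt_id z).const_mul a).add_const b
  have hden : HasDerivAt (fun z => conj b * z + conj a) (conj b) z := by
    simpa using ((hasDerivAt_id z).const_mul (conj b)).add_const (conj a)
  exact (hnum.div hden (diskMobius_denom_ne_zero h hz)).congr_deriv (by ring)

lemma mul_conj_sub_mul_conj_ne_zero {a b : ℂ} (h : ‖b‖ < ‖a‖) :
    a * conj a - b * conj b ≠ 0 := by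
  rw [Complex.mul_conj', Complex.mul_conj', sub_ne_zero]
  norm_cast
  nlinarith [norm_nonneg b]

lemma one_sub_norm_diskMobius_sq {a b z : ℂ} (h : ‖b‖ < ‖a‖) (hz : ‖z‖ < 1) :
    1 - ‖diskMobius a b z‖ ^ 2 = (1 - ‖z‖ ^ 2) * ‖deriv (diskMobius a b) z‖ := by
  have hd := diskMobius_denom_ne_zero h hz
  have hdet : ‖a * conj a - b * conj b‖ = ‖a‖ ^ 2 - ‖b‖ ^ 2 := by
    rw [Complex.mul_conj', Complex.mul_conj', ← Complex.ofReal_pow, ← Complex.ofReal_pow,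
      ← Complex.ofReal_sub, Complex.norm_of_nonneg]
    nlinarith [norm_nonneg b]
  have hkey : ‖conj b * z + conj a‖ ^ 2 - ‖a * z + b‖ ^ 2
      = (1 - ‖z‖ ^ 2) * (‖a‖ ^ 2 - ‖b‖ ^ 2) := by
    apply Complex.ofReal_injective
    push_cast
    simp only [← Complex.mul_conj', map_add, map_mul, Complex.conj_conj]
    ring
  have hd' : ‖conj b * z + conj a‖ ≠ 0 := norm_ne_zero_iff.mpr hd
  rw [(hasDerivAt_diskMobius h hz).deriv, norm_div, norm_pow, hdet, diskMobius, norm_div,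
    mul_div_assoc', ← hkey, sub_div, div_self (pow_ne_zero 2 hd'), div_pow]

lemma norm_diskMobius_lt_one {a b z : ℂ} (h : ‖b‖ < ‖a‖) (hz : ‖z‖ < 1) :
    ‖diskMobius a b z‖ < 1 := by
  have hderiv : 0 < ‖deriv (diskMobius a b) z‖ := by
    rw [(hasDerivAt_diskMobius h hz).deriv, norm_pos_iff]
    exact div_ne_zero (mul_conj_sub_mul_conj_ne_zero h)
      (pow_ne_zero 2 (diskMobius_denom_ne_zero h hz))
  have hpos : 0 < 1 - ‖diskMobius a b z‖ ^ 2 := by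
    rw [one_sub_norm_diskMobius_sq h hz]
    exact mul_pos (by nlinarith [norm_nonneg z]) hderiv
  nlinarith [norm_nonneg (diskMobius a b z)]

lemma one_sub_mul_ne_zero_of_norm_lt_one {z w : ℂ} (hz : ‖z‖ < 1) (hw : ‖w‖ < 1) :
    1 - z * w ≠ 0 := by
  intro h0
  have hn : ‖z * w‖ = 1 := by rw [← sub_eq_zero.mp h0, norm_one]
  rw [norm_mul] at hn
  nlinarith [norm_nonneg z, norm_nonneg w]

/-- Mirror automorphisms have mirror conformal derivative `1`. -/
lemma deriv_diskMobius_mul_deriv_diskMobius {a b z w : ℂ} (h : ‖b‖ < ‖a‖)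
    (hz : ‖z‖ < 1) (hw : ‖w‖ < 1) :
    deriv (diskMobius a b) z * deriv (diskMobius (conj a) (conj b)) w * (1 - z * w) ^ 2
      = (1 - diskMobius a b z * diskMobius (conj a) (conj b) w) ^ 2 := by
  have h' : ‖conj b‖ < ‖conj a‖ := by simpa using h
  have hd := diskMobius_denom_ne_zero h hz
  have hd' := diskMobius_denom_ne_zero h' hw
  rw [(hasDerivAt_diskMobius h hz).deriv, (hasDerivAt_diskMobius h' hw).deriv]
  simp only [diskMobius, Complex.conj_conj] at hd' ⊢
  field_simp
  ring

lemma mirrorDsq_comm (ψ₁ ψ₂ : ℂ → ℂ) (z₁ z₂ : ℂ) :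
    mirrorDsq ψ₁ ψ₂ z₁ z₂ = mirrorDsq ψ₂ ψ₁ z₂ z₁ := by
  simp only [mirrorDsq, mul_comm z₁ z₂, mul_comm (ψ₁ z₁), mul_comm (deriv ψ₁ z₁)]

lemma deriv_diskMobius_comp_comp {ψ : ℂ → ℂ} (hψ : DifferentiableOn ℂ ψ (ball 0 1))
    (hmap : ∀ z ∈ ball (0 : ℂ) 1, ψ z ∈ ball (0 : ℂ) 1) {a b c d u : ℂ}
    (h : ‖b‖ < ‖a‖) (h' : ‖d‖ < ‖c‖) (hu : ‖u‖ < 1) :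
    deriv (diskMobius c d ∘ ψ ∘ diskMobius a b) u =
      deriv (diskMobius c d) (ψ (diskMobius a b u)) *
        (deriv ψ (diskMobius a b u) * deriv (diskMobius a b) u) := by
  have hz : diskMobius a b u ∈ ball (0 : ℂ) 1 :=
    mem_ball_zero_iff.mpr (norm_diskMobius_lt_one h hu)
  have hψz := (hψ.differentiableAt (isOpen_ball.mem_nhds hz)).hasDerivAt
  have hR := (hasDerivAt_diskMobius h hu).differentiableAt.hasDerivAt
  have hS := (hasDerivAt_diskMobius h'
    (mem_ball_zero_iff.mp (hmap _ hz))).differentiableAt.hasDerivAt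
  exact (HasDerivAt.comp u hS (hψz.comp u hR)).deriv

/-- The mirror conformal derivative is invariant under mirror automorphisms in the source and in
the image. -/
lemma mirrorDsq_diskMobius_comp_comp {ψ₁ ψ₂ : ℂ → ℂ}
    (hψ₁ : DifferentiableOn ℂ ψ₁ (ball 0 1)) (hψ₂ : DifferentiableOn ℂ ψ₂ (ball 0 1))
    (hmap₁ : ∀ z ∈ ball (0 : ℂ) 1, ψ₁ z ∈ ball (0 : ℂ) 1)
    (hmap₂ : ∀ z ∈ ball (0 : ℂ) 1, ψ₂ z ∈ ball (0 : ℂ) 1)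
    {a b c d u v : ℂ} (h : ‖b‖ < ‖a‖) (h' : ‖d‖ < ‖c‖) (hu : ‖u‖ < 1) (hv : ‖v‖ < 1) :
    mirrorDsq (diskMobius c d ∘ ψ₁ ∘ diskMobius a b)
        (diskMobius (conj c) (conj d) ∘ ψ₂ ∘ diskMobius (conj a) (conj b)) u v =
      mirrorDsq ψ₁ ψ₂ (diskMobius a b u) (diskMobius (conj a) (conj b) v) := by
  have hc : ‖conj b‖ < ‖conj a‖ := by simpa using h
  have hc' : ‖conj d‖ < ‖conj c‖ := by simpa using h'
  have hz := norm_diskMobius_lt_one h hu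
  have hw := norm_diskMobius_lt_one hc hv
  have hψz := mem_ball_zero_iff.mp (hmap₁ _ (mem_ball_zero_iff.mpr hz))
  have hψw := mem_ball_zero_iff.mp (hmap₂ _ (mem_ball_zero_iff.mpr hw))
  have hR := deriv_diskMobius_mul_deriv_diskMobius h hu hv
  have hS := deriv_diskMobius_mul_deriv_diskMobius h' hψz hψw
  have hne := one_sub_mul_ne_zero_of_norm_lt_one hψz hψw
  have hne' := one_sub_mul_ne_zero_of_norm_lt_one
    (norm_diskMobius_lt_one h' hψz) (norm_diskMobius_lt_one hc' hψw)
  simp only [mirrorDsq]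
  rw [deriv_diskMobius_comp_comp hψ₁ hmap₁ h h' hu, deriv_diskMobius_comp_comp hψ₂ hmap₂ hc hc' hv]
  simp only [Function.comp_apply]
  rw [div_eq_div_iff (pow_ne_zero 2 hne') (pow_ne_zero 2 hne), ← hS, ← hR]
  ring

lemma differentiableAt_mirrorDsq_left {ψ₁ ψ₂ : ℂ → ℂ}
    (hψ₁ : DifferentiableOn ℂ ψ₁ (ball 0 1)) {z w : ℂ} (hz : z ∈ ball (0 : ℂ) 1)
    (hne : 1 - ψ₁ z * ψ₂ w ≠ 0) :
    DifferentiableAt ℂ (fun z => mirrorDsq ψ₁ ψ₂ z w) z := by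
  have hψz := hψ₁.differentiableAt (isOpen_ball.mem_nhds hz)
  have hψz' := (hψ₁.deriv isOpen_ball).differentiableAt (isOpen_ball.mem_nhds hz)
  have hden : DifferentiableAt ℂ (fun z => (1 - ψ₁ z * ψ₂ w) ^ 2) z := by fun_prop
  have hnum : DifferentiableAt ℂ (fun z => deriv ψ₁ z * deriv ψ₂ w * (1 - z * w) ^ 2) z := by
    fun_prop
  exact hnum.div hden (pow_ne_zero 2 hne)

lemma mirror_distortion_left_diskMobius {ψ₁ ψ₂ : ℂ → ℂ}
    (hψ₁ : DifferentiableOn ℂ ψ₁ (ball 0 1)) (hψ₂ : DifferentiableOn ℂ ψ₂ (ball 0 1))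
    (hmap₁ : ∀ z ∈ ball (0 : ℂ) 1, ψ₁ z ∈ ball (0 : ℂ) 1)
    (hmap₂ : ∀ z ∈ ball (0 : ℂ) 1, ψ₂ z ∈ ball (0 : ℂ) 1)
    {a b c d u v : ℂ} (h : ‖b‖ < ‖a‖) (h' : ‖d‖ < ‖c‖) (hu : ‖u‖ < 1) (hv : ‖v‖ < 1) :
    (1 - ‖diskMobius a b u‖ ^ 2) *
        ‖deriv (fun z => mirrorDsq ψ₁ ψ₂ z (diskMobius (conj a) (conj b) v)) (diskMobius a b u) /
          mirrorDsq ψ₁ ψ₂ (diskMobius a b u) (diskMobius (conj a) (conj b) v)‖ =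
      (1 - ‖u‖ ^ 2) *
        ‖deriv (fun z => mirrorDsq (diskMobius c d ∘ ψ₁ ∘ diskMobius a b)
            (diskMobius (conj c) (conj d) ∘ ψ₂ ∘ diskMobius (conj a) (conj b)) z v) u /
          mirrorDsq (diskMobius c d ∘ ψ₁ ∘ diskMobius a b)
            (diskMobius (conj c) (conj d) ∘ ψ₂ ∘ diskMobius (conj a) (conj b)) u v‖ := by
  have hc : ‖conj b‖ < ‖conj a‖ := by simpa using h
  have hz := mem_ball_zero_iff.mpr (norm_diskMobius_lt_one h hu)
  have hw := mem_ball_zero_iff.mpr (norm_diskMobius_lt_one hc hv)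
  have hne := one_sub_mul_ne_zero_of_norm_lt_one
    (mem_ball_zero_iff.mp (hmap₁ _ hz)) (mem_ball_zero_iff.mp (hmap₂ _ hw))
  have hR := (hasDerivAt_diskMobius h hu).differentiableAt.hasDerivAt
  have hD := (differentiableAt_mirrorDsq_left hψ₁ hz hne).hasDerivAt
  have heq : (fun z => mirrorDsq (diskMobius c d ∘ ψ₁ ∘ diskMobius a b)
        (diskMobius (conj c) (conj d) ∘ ψ₂ ∘ diskMobius (conj a) (conj b)) z v) =ᶠ[nhds u]
      (fun z => mirrorDsq ψ₁ ψ₂ z (diskMobius (conj a) (conj b) v)) ∘ diskMobius a b := by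
    filter_upwards [isOpen_ball.mem_nhds (mem_ball_zero_iff.mpr hu)] with z hz
    exact mirrorDsq_diskMobius_comp_comp hψ₁ hψ₂ hmap₁ hmap₂ h h' (mem_ball_zero_iff.mp hz) hv
  rw [heq.deriv_eq, (HasDerivAt.comp u hD hR).deriv,
    mirrorDsq_diskMobius_comp_comp hψ₁ hψ₂ hmap₁ hmap₂ h h' hu hv,
    one_sub_norm_diskMobius_sq h hu, norm_div, norm_div, norm_mul]
  ring

/-- **Conformal invariance of the mirror distortion.** The quantity
`(1−|z_i|²)·|∂_{z_i} DΨ²/DΨ²|` is invariant under composing with mirror automorphisms in the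
source and in the image. -/
theorem mirror_distortion_invariance
    (ψ₁ ψ₂ : ℂ → ℂ)
    (hψ₁ : DifferentiableOn ℂ ψ₁ (ball (0 : ℂ) 1))
    (hψ₂ : DifferentiableOn ℂ ψ₂ (ball (0 : ℂ) 1))
    (hmap₁ : ∀ z ∈ ball (0 : ℂ) 1, ψ₁ z ∈ ball (0 : ℂ) 1)
    (hmap₂ : ∀ z ∈ ball (0 : ℂ) 1, ψ₂ z ∈ ball (0 : ℂ) 1)
    (hcrit₁ : ∀ z ∈ ball (0 : ℂ) 1, deriv ψ₁ z ≠ 0)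
    (hcrit₂ : ∀ z ∈ ball (0 : ℂ) 1, deriv ψ₂ z ≠ 0)
    (a₁ b₁ a₂ b₂ : ℂ)
    (h₁ : norm b₁ < norm a₁) (h₂ : norm b₂ < norm a₂)
    (R₁ Rb₁ R₂ Rb₂ : ℂ → ℂ)
    (hR₁ : ∀ z : ℂ, R₁ z = (a₁ * z + b₁) / ((starRingEnd ℂ) b₁ * z + (starRingEnd ℂ) a₁))
    (hRb₁ : ∀ w : ℂ, Rb₁ w = ((starRingEnd ℂ) a₁ * w + (starRingEnd ℂ) b₁) / (b₁ * w + a₁))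
    (hR₂ : ∀ z : ℂ, R₂ z = (a₂ * z + b₂) / ((starRingEnd ℂ) b₂ * z + (starRingEnd ℂ) a₂))
    (hRb₂ : ∀ w : ℂ, Rb₂ w = ((starRingEnd ℂ) a₂ * w + (starRingEnd ℂ) b₂) / (b₂ * w + a₂)) :
    ∀ u₁ ∈ ball (0 : ℂ) 1, ∀ u₂ ∈ ball (0 : ℂ) 1,
      ((1 - norm (R₁ u₁) ^ 2) *
          norm (deriv (fun w => mirrorDsq ψ₁ ψ₂ w (Rb₁ u₂)) (R₁ u₁) /
            mirrorDsq ψ₁ ψ₂ (R₁ u₁) (Rb₁ u₂)) =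
        (1 - norm u₁ ^ 2) *
          norm (deriv (fun w => mirrorDsq (R₂ ∘ ψ₁ ∘ R₁) (Rb₂ ∘ ψ₂ ∘ Rb₁) w u₂) u₁ /
            mirrorDsq (R₂ ∘ ψ₁ ∘ R₁) (Rb₂ ∘ ψ₂ ∘ Rb₁) u₁ u₂)) ∧
      ((1 - norm (Rb₁ u₂) ^ 2) *
          norm (deriv (fun w => mirrorDsq ψ₁ ψ₂ (R₁ u₁) w) (Rb₁ u₂) /
            mirrorDsq ψ₁ ψ₂ (R₁ u₁) (Rb₁ u₂)) =
        (1 - norm u₂ ^ 2) *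
          norm (deriv (fun w => mirrorDsq (R₂ ∘ ψ₁ ∘ R₁) (Rb₂ ∘ ψ₂ ∘ Rb₁) u₁ w) u₂ /
            mirrorDsq (R₂ ∘ ψ₁ ∘ R₁) (Rb₂ ∘ ψ₂ ∘ Rb₁) u₁ u₂)) := by
  intro u₁ hu₁ u₂ hu₂
  rw [mem_ball_zero_iff] at hu₁ hu₂
  obtain rfl : R₁ = diskMobius a₁ b₁ := funext hR₁
  obtain rfl : R₂ = diskMobius a₂ b₂ := funext hR₂
  obtain rfl : Rb₁ = diskMobius (conj a₁) (conj b₁) := by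
    ext w
    simp only [hRb₁, diskMobius, Complex.conj_conj]
  obtain rfl : Rb₂ = diskMobius (conj a₂) (conj b₂) := by
    ext w
    simp only [hRb₂, diskMobius, Complex.conj_conj]
  refine ⟨mirror_distortion_left_diskMobius hψ₁ hψ₂ hmap₁ hmap₂ h₁ h₂ hu₁ hu₂, ?_⟩
  have h₁' : ‖conj b₁‖ < ‖conj a₁‖ := by simpa using h₁
  have h₂' : ‖conj b₂‖ < ‖conj a₂‖ := by simpa using h₂
  have key := mirror_distortion_left_diskMobius hψ₂ hψ₁ hmap₂ hmap₁ h₁' h₂' hu₂ hu₁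
  simp only [Complex.conj_conj] at key
  simpa only [mirrorDsq_comm ψ₁, mirrorDsq_comm (_ ∘ ψ₁ ∘ _)] using key

end
end

section
/- Mirror Koebe distortion: Let ψ₁,ψ₂:𝔻→𝔻 be holomorphic maps without critical points and let Ψ=(ψ₁,ψ₂) with mirror conformal derivative DΨ². Then for every (z₁,z₂)∈𝔻², with ρ_i=ρ[ψ_i](z_i) the Euclidean radius of injectivity of ψ_i at z_i, one has for i=1,2: (1−|z_i|²)·|∂_{z_i}DΨ²(z₁,z₂)/DΨ²(z₁,z₂)| ≤ 2 + 4/ρ_i. -/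
open Complex Metric

noncomputable section

/-- the Euclidean radius of injectivity of `ψ` at `z`: the supremum of `ρ ∈ (0,1]` such that
`ψ ∘ R` is injective on the Euclidean disk of radius `ρ`, where `R` is the Möbius automorphism
of the disk with `R 0 = z`. -/
def injRad (ψ : ℂ → ℂ) (z : ℂ) : ℝ :=
  sSup {ρ : ℝ | 0 < ρ ∧ ρ ≤ 1 ∧
    Set.InjOn (fun w => ψ ((w + z) / (1 + (starRingEnd ℂ) z * w))) (ball (0 : ℂ) ρ)}

theorem exists_sq_mul_eq_one {φ : ℂ → ℂ} (hφ : DifferentiableOn ℂ φ (ball 0 1))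
    (h0 : φ 0 = 1) (hne : ∀ z ∈ ball (0 : ℂ) 1, φ z ≠ 0) :
    ∃ E : ℂ → ℂ, DifferentiableOn ℂ E (ball 0 1) ∧ E 0 = 1 ∧
      ∀ z ∈ ball (0 : ℂ) 1, E z ^ 2 * φ z = 1 := by
  have hd : DifferentiableOn ℂ (deriv φ) (ball 0 1) := hφ.deriv isOpen_ball
  obtain ⟨L, hL0, hL⟩ := ((hd.div hφ hne).isExactOn_ball).with_val_at 0 0
  have hLd : DifferentiableOn ℂ L (ball 0 1) := fun z hz =>
    (hL z hz).differentiableAt.differentiableWithinAt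
  have hconst : ∀ z ∈ ball (0 : ℂ) 1, cexp (-L z) * φ z = 1 := by
    intro z hz
    have key : ∀ w ∈ ball (0 : ℂ) 1, HasDerivAt (fun w => cexp (-L w) * φ w) 0 w := by
      intro w hw
      have h1 := (hL w hw).neg.cexp.mul
        ((hφ.differentiableAt (isOpen_ball.mem_nhds hw)).hasDerivAt)
      refine h1.congr_deriv ?_
      have := hne w hw
      simp only [Pi.div_apply, Pi.neg_apply]
      field_simp
      ring
    have := isOpen_ball.is_const_of_deriv_eq_zero (convex_ball (0 : ℂ) 1).isPreconnected
      (fun w hw => (key w hw).differentiableAt.differentiableWithinAt)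
      (fun w hw => (key w hw).deriv) hz (mem_ball_self one_pos)
    simpa [hL0, h0] using this
  refine ⟨fun z => cexp (-L z / 2), by fun_prop, by simp [hL0], fun z hz => ?_⟩
  rw [← Complex.exp_nat_mul, ← hconst z hz]
  congr 2
  push_cast; ring

theorem one_add_sq_le_integral_norm_sq_circleMap {q : ℂ → ℂ}
    (hq : DifferentiableOn ℂ q (ball 0 1)) (h0 : q 0 = 1) {s : ℝ} (hs : 0 < s) (hs1 : s < 1) :
    2 * Real.pi * (1 + ‖deriv q 0‖ ^ 2 * s ^ 2) ≤
      ∫ θ in -Real.pi..Real.pi, ‖q (circleMap 0 s θ)‖ ^ 2 := by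
  set b := deriv q 0 with hb
  have hn : ball (0 : ℂ) 1 ∈ nhds 0 := ball_mem_nhds _ one_pos
  have hd1 : DifferentiableOn ℂ (dslope q 0) (ball 0 1) :=
    (Complex.differentiableOn_dslope hn).2 hq
  set h := dslope (dslope q 0) 0
  have hd2 : DifferentiableOn ℂ h (ball 0 1) := (Complex.differentiableOn_dslope hn).2 hd1
  have hexp : ∀ z, q z = 1 + b * z + z ^ 2 * h z := by
    intro z
    have e1 := sub_smul_dslope q 0 z
    have e2 := sub_smul_dslope (dslope q 0) 0 z
    rw [dslope_same, ← hb] at e2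
    simp only [sub_zero, smul_eq_mul, h0] at e1 e2
    linear_combination -e1 - z * e2
  let H : ℂ → ℂ := fun z => b * z + z ^ 2 * h z + (starRingEnd ℂ) b * s ^ 2 * z * h z
  have hHd : DifferentiableOn ℂ H (ball 0 1) := by fun_prop
  have hsub : closedBall (0 : ℂ) s ⊆ ball 0 1 := closedBall_subset_ball hs1
  have hcirc : ∀ θ, circleMap 0 s θ ∈ closedBall (0 : ℂ) s := fun θ =>
    circleMap_mem_closedBall 0 hs.le θ
  have hpt : ∀ θ, 1 + ‖b‖ ^ 2 * s ^ 2 + 2 * (H (circleMap 0 s θ)).re ≤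
      ‖q (circleMap 0 s θ)‖ ^ 2 := by
    intro θ
    have hz : circleMap 0 s θ * (starRingEnd ℂ) (circleMap 0 s θ) = (s : ℂ) ^ 2 := by
      rw [Complex.mul_conj, Complex.normSq_eq_norm_sq, norm_circleMap_zero, sq_abs]
      push_cast; ring
    set z := circleMap 0 s θ
    have hp : ‖1 + b * z‖ ^ 2 = 1 + ‖b‖ ^ 2 * s ^ 2 + 2 * (b * z).re := by
      have : ‖z‖ ^ 2 = s ^ 2 := by simp [z]
      rw [← this, ← mul_pow, ← norm_mul, ← Complex.normSq_eq_norm_sq, Complex.normSq_add,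
        Complex.normSq_eq_norm_sq, Complex.normSq_eq_norm_sq]
      simp
    have hH : (H z).re = (b * z).re + ((1 + b * z) * (starRingEnd ℂ) (z ^ 2 * h z)).re := by
      have : (1 + b * z) * (starRingEnd ℂ) (z ^ 2 * h z) =
          (starRingEnd ℂ) ((1 + (starRingEnd ℂ) b * (starRingEnd ℂ) z) * (z ^ 2 * h z)) := by
        simp
      rw [this, Complex.conj_re, ← Complex.add_re]
      congr 1
      simp only [H]
      linear_combination (-(starRingEnd ℂ) b * z * h z) * hz
    have : ‖q z‖ ^ 2 = ‖1 + b * z‖ ^ 2 + ‖z ^ 2 * h z‖ ^ 2 +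
        2 * ((1 + b * z) * (starRingEnd ℂ) (z ^ 2 * h z)).re := by
      rw [hexp z, ← Complex.normSq_eq_norm_sq, Complex.normSq_add, Complex.normSq_eq_norm_sq,
        Complex.normSq_eq_norm_sq]
    rw [this, hp, hH]
    nlinarith [sq_nonneg ‖z ^ 2 * h z‖]
  have hcm : Continuous fun θ : ℝ => circleMap 0 s θ := continuous_circleMap 0 s
  have hHc : Continuous fun θ : ℝ => H (circleMap 0 s θ) :=
    hHd.continuousOn.comp_continuous hcm fun θ => hsub (hcirc θ)
  have hqc : Continuous fun θ : ℝ => q (circleMap 0 s θ) :=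
    hq.continuousOn.comp_continuous hcm fun θ => hsub (hcirc θ)
  have hper : (fun θ : ℝ => H (circleMap 0 s θ)).Periodic (2 * Real.pi) := fun x => by
    simp [periodic_circleMap 0 s x]
  have hint0 : ∫ θ in -Real.pi..Real.pi, H (circleMap 0 s θ) = 0 := by
    have h1 := DiffContOnCl.circleAverage (f := H) (c := 0) (R := s)
      ((hHd.mono (by rw [abs_of_pos hs]; exact hsub)).diffContOnCl_ball subset_rfl)
    rw [Real.circleAverage_def] at h1
    have h2 := hper.intervalIntegral_add_eq 0 (-Real.pi)
    rw [zero_add, show -Real.pi + 2 * Real.pi = Real.pi by ring] at h2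
    rw [← h2]
    have hH0 : H 0 = 0 := by simp [H]
    rw [hH0, smul_eq_zero] at h1
    exact h1.resolve_left (by positivity)
  have hre : ∫ θ in -Real.pi..Real.pi, (H (circleMap 0 s θ)).re = 0 := by
    have := Complex.reCLM.intervalIntegral_comp_comm
      (hHc.intervalIntegrable (μ := MeasureTheory.volume) (-Real.pi) Real.pi)
    simpa [hint0] using this
  have hrec : Continuous fun θ : ℝ => (H (circleMap 0 s θ)).re := Complex.continuous_re.comp hHc
  calc _ = ∫ θ in -Real.pi..Real.pi,
          (1 + ‖b‖ ^ 2 * s ^ 2 + 2 * (H (circleMap 0 s θ)).re) := by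
        rw [intervalIntegral.integral_add (by simp) ((hrec.const_mul 2).intervalIntegrable _ _),
          intervalIntegral.integral_const_mul, hre]
        simp; ring
    _ ≤ _ := by
        apply intervalIntegral.integral_mono_on (by linarith [Real.pi_pos])
        · exact (by fun_prop : Continuous _).intervalIntegrable _ _
        · exact (hqc.norm.pow 2).intervalIntegrable _ _
        · exact fun θ _ => hpt θ

open MeasureTheory in
theorem Complex.lintegral_eq_lintegral_lintegral_circleMap {G : ℂ → ENNReal} (hG : Measurable G) :
    ∫⁻ z, G z = ∫⁻ s in Set.Ioi (0 : ℝ), ∫⁻ θ in Set.Ioo (-Real.pi) Real.pi,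
      ENNReal.ofReal s * G (circleMap 0 s θ) := by
  rw [← Complex.lintegral_comp_polarCoord_symm, polarCoord_target, Measure.volume_eq_prod,
    ← Measure.prod_restrict, lintegral_prod]
  · simp [circleMap, Complex.exp_mul_I]
  · have : Measurable fun p : ℝ × ℝ => Complex.polarCoord.symm p := by
      simp only [Complex.polarCoord_symm_apply]; fun_prop
    exact (((ENNReal.measurable_ofReal.comp measurable_fst).mul
      (hG.comp this))).aemeasurable

open MeasureTheory in
theorem Complex.lintegral_eq_lintegral_lintegral_circleMap_symm {G : ℂ → ENNReal}
    (hG : Measurable G) :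
    ∫⁻ z, G z = ∫⁻ θ in Set.Ioo (-Real.pi) Real.pi, ∫⁻ s in Set.Ioi (0 : ℝ),
      ENNReal.ofReal s * G (circleMap 0 s θ) := by
  rw [lintegral_eq_lintegral_lintegral_circleMap hG, lintegral_lintegral_swap]
  have : Measurable fun p : ℝ × ℝ => circleMap 0 p.1 p.2 := by
    unfold circleMap; fun_prop
  exact ((ENNReal.measurable_ofReal.comp measurable_fst).mul (hG.comp this)).aemeasurable

open MeasureTheory in
theorem lintegral_Ici_ofReal_rpow_neg_two {c : ℝ} (hc : 0 < c) :
    ∫⁻ s in Set.Ici c, ENNReal.ofReal (s ^ (-2 : ℝ)) = ENNReal.ofReal c⁻¹ := by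
  rw [setLIntegral_congr Ioi_ae_eq_Ici.symm, ← ofReal_integral_eq_lintegral_ofReal
    (integrableOn_Ioi_rpow_of_lt (by norm_num) hc), integral_Ioi_rpow_of_lt (by norm_num) hc]
  · norm_num [Real.rpow_neg_one]
  · filter_upwards [ae_restrict_mem measurableSet_Ioi] with x hx
    exact Real.rpow_nonneg (hc.trans hx).le _

open MeasureTheory in
/-- The exterior of a conic with focus `0` has explicit area for the weight `‖w‖⁻³`. -/
theorem lintegral_inv_norm_cube_conic {a : ℂ} {κ : ℝ} (hκ : ‖a‖ < κ) :
    ∫⁻ w in {w : ℂ | 1 ≤ κ * ‖w‖ - (a * w).re}, ENNReal.ofReal (1 / ‖w‖ ^ 3) =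
      ENNReal.ofReal (2 * Real.pi * κ) := by
  have hK : MeasurableSet {w : ℂ | 1 ≤ κ * ‖w‖ - (a * w).re} :=
    measurableSet_le measurable_const (by fun_prop)
  have hm : ∀ θ : ℝ, 0 < κ - (a * circleMap 0 1 θ).re := fun θ => by
    have := (Complex.re_le_norm (a * circleMap 0 1 θ))
    rw [norm_mul, norm_circleMap_zero, abs_one, mul_one] at this
    linarith
  rw [← lintegral_indicator hK, Complex.lintegral_eq_lintegral_lintegral_circleMap_symm]
  swap
  · exact Measurable.indicator (by fun_prop) hK
  have hin : ∀ θ : ℝ, ∫⁻ s in Set.Ioi (0 : ℝ), ENNReal.ofReal s *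
      ({w : ℂ | 1 ≤ κ * ‖w‖ - (a * w).re}.indicator (fun w => ENNReal.ofReal (1 / ‖w‖ ^ 3)))
        (circleMap 0 s θ) = ENNReal.ofReal (κ - (a * circleMap 0 1 θ).re) := by
    intro θ
    have hc : 0 < (κ - (a * circleMap 0 1 θ).re)⁻¹ := inv_pos.2 (hm θ)
    conv_rhs => rw [← inv_inv (κ - (a * circleMap 0 1 θ).re)]
    rw [← lintegral_Ici_ofReal_rpow_neg_two hc, ← lintegral_indicator measurableSet_Ioi,
      ← lintegral_indicator measurableSet_Ici]
    congr 1
    ext s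
    by_cases hs : 0 < s
    · rw [Set.indicator_of_mem (by simpa using hs)]
      have hmem : circleMap 0 s θ ∈ {w : ℂ | 1 ≤ κ * ‖w‖ - (a * w).re} ↔
          s ∈ Set.Ici (κ - (a * circleMap 0 1 θ).re)⁻¹ := by
        have e : circleMap 0 s θ = s * circleMap 0 1 θ := by simp [circleMap]
        have e2 : (a * (s * circleMap 0 1 θ)).re = s * (a * circleMap 0 1 θ).re := by
          rw [mul_left_comm, Complex.re_ofReal_mul]
        rw [Set.mem_ofPred_eq, norm_circleMap_zero, abs_of_pos hs, e, e2, Set.mem_Ici,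
          inv_le_iff_one_le_mul₀ (hm θ)]
        ring_nf
      by_cases h : s ∈ Set.Ici (κ - (a * circleMap 0 1 θ).re)⁻¹
      · rw [Set.indicator_of_mem (hmem.2 h), Set.indicator_of_mem h, ← ENNReal.ofReal_mul hs.le,
          norm_circleMap_zero, abs_of_pos hs]
        congr 1
        rw [Real.rpow_neg hs.le]
        norm_cast
        field_simp
      · rw [Set.indicator_of_notMem (fun h' => h (hmem.1 h')), Set.indicator_of_notMem h, mul_zero]
    · rw [Set.indicator_of_notMem (by simpa using hs), Set.indicator_of_notMem]
      simp only [Set.mem_Ici, not_le]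
      exact (not_lt.1 hs).trans_lt hc
  simp_rw [hin]
  have hcont : Continuous fun θ : ℝ => κ - (a * circleMap 0 1 θ).re := by
    have := continuous_circleMap 0 1
    fun_prop
  have hintv : IntegrableOn (fun θ : ℝ => κ - (a * circleMap 0 1 θ).re)
      (Set.Ioo (-Real.pi) Real.pi) :=
    (hcont.integrableOn_Icc).mono_set Set.Ioo_subset_Icc_self
  rw [← ofReal_integral_eq_lintegral_ofReal hintv (Filter.Eventually.of_forall fun θ => (hm θ).le),
    ← integral_Ioc_eq_integral_Ioo, ← intervalIntegral.integral_of_le (by linarith [Real.pi_pos])]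
  congr 1
  have hc2 : Continuous fun θ : ℝ => a * circleMap 0 1 θ := by
    have := continuous_circleMap 0 1
    fun_prop
  have h0 : ∫ θ in -Real.pi..Real.pi, (a * circleMap 0 1 θ).re = 0 := by
    have h1 := Complex.reCLM.intervalIntegral_comp_comm
      (hc2.intervalIntegrable (μ := volume) (-Real.pi) Real.pi)
    have h2 : ∫ θ in -Real.pi..Real.pi, a * circleMap 0 1 θ = 0 := by
      rw [intervalIntegral.integral_const_mul]
      simp only [circleMap, zero_add, ofReal_one, one_mul]
      have : ∀ x : ℝ, cexp (x * I) = cexp (I * x) := fun x => by rw [mul_comm]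
      simp_rw [this]
      rw [integral_exp_mul_complex I_ne_zero]
      have e1 : cexp (I * (Real.pi : ℝ)) = -1 := by rw [mul_comm, exp_pi_mul_I]
      have e2 : cexp (I * ((-Real.pi : ℝ) : ℂ)) = -1 := by
        rw [Complex.ofReal_neg, mul_neg, Complex.exp_neg, e1]; norm_num
      rw [e1, e2]; simp
    simpa [h2] using h1
  have hc3 : Continuous fun θ : ℝ => (a * circleMap 0 1 θ).re := Complex.continuous_re.comp hc2
  rw [intervalIntegral.integral_sub (by simp) (hc3.intervalIntegrable _ _), h0,
    intervalIntegral.integral_const, smul_eq_mul]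
  ring

open MeasureTheory in
theorem le_lintegral_annulus_norm_sq {q : ℂ → ℂ}
    (hq : DifferentiableOn ℂ q (ball 0 1)) (h0 : q 0 = 1) {r R : ℝ} (hr : 0 < r) (hrR : r < R)
    (hR : R < 1) :
    ENNReal.ofReal (2 * Real.pi * (r⁻¹ - R⁻¹ + ‖deriv q 0‖ ^ 2 * (R - r))) ≤
      ∫⁻ z in {z : ℂ | r ≤ ‖z‖ ∧ ‖z‖ ≤ R}, ENNReal.ofReal (‖q z‖ ^ 2 / ‖z‖ ^ 3) := by
  set A := {z : ℂ | r ≤ ‖z‖ ∧ ‖z‖ ≤ R}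
  have hA : MeasurableSet A :=
    (measurableSet_le measurable_const measurable_norm).inter
      (measurableSet_le measurable_norm measurable_const)
  have hAsub : A ⊆ ball 0 1 := fun z hz => by
    rw [mem_ball_zero_iff]; exact hz.2.trans_lt hR
  have hmeas : Measurable (A.indicator fun z => ENNReal.ofReal (‖q z‖ ^ 2 / ‖z‖ ^ 3)) := by
    have hc : ContinuousOn (fun z => ENNReal.ofReal (‖q z‖ ^ 2 / ‖z‖ ^ 3)) A := by
      refine ENNReal.continuous_ofReal.comp_continuousOn (ContinuousOn.div ?_ (by fun_prop) ?_)
      · exact ((hq.continuousOn.mono hAsub).norm).pow 2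
      · intro z hz
        have : 0 < ‖z‖ := hr.trans_le hz.1
        positivity
    rw [← Set.piecewise_eq_indicator]
    exact hc.measurable_piecewise continuousOn_const hA
  rw [← lintegral_indicator hA, Complex.lintegral_eq_lintegral_lintegral_circleMap hmeas]
  have hinner : ∀ s ∈ Set.Icc r R,
      ENNReal.ofReal (2 * Real.pi * ((s ^ 2)⁻¹ + ‖deriv q 0‖ ^ 2)) ≤
      ∫⁻ θ in Set.Ioo (-Real.pi) Real.pi, ENNReal.ofReal s *
        (A.indicator fun z => ENNReal.ofReal (‖q z‖ ^ 2 / ‖z‖ ^ 3)) (circleMap 0 s θ) := by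
    intro s hs
    have hs0 : 0 < s := hr.trans_le hs.1
    have hmem : ∀ θ, circleMap 0 s θ ∈ A := fun θ => by
      simpa [A, abs_of_pos hs0] using hs
    have hqc : Continuous fun θ : ℝ => q (circleMap 0 s θ) :=
      hq.continuousOn.comp_continuous (continuous_circleMap 0 s) fun θ => hAsub (hmem θ)
    have hqc2 : Continuous fun θ : ℝ => (s ^ 2)⁻¹ * ‖q (circleMap 0 s θ)‖ ^ 2 :=
      continuous_const.mul (hqc.norm.pow 2)
    have e : ∀ θ, ENNReal.ofReal s *
        (A.indicator fun z => ENNReal.ofReal (‖q z‖ ^ 2 / ‖z‖ ^ 3)) (circleMap 0 s θ) =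
        ENNReal.ofReal ((s ^ 2)⁻¹ * ‖q (circleMap 0 s θ)‖ ^ 2) := by
      intro θ
      rw [Set.indicator_of_mem (hmem θ), ← ENNReal.ofReal_mul hs0.le, norm_circleMap_zero,
        abs_of_pos hs0]
      congr 1
      field_simp
    simp_rw [e]
    rw [← ofReal_integral_eq_lintegral_ofReal
      (hqc2.integrableOn_Icc.mono_set Set.Ioo_subset_Icc_self)
      (Filter.Eventually.of_forall fun θ => by positivity), ← integral_Ioc_eq_integral_Ioo,
      ← intervalIntegral.integral_of_le (by linarith [Real.pi_pos]),
      intervalIntegral.integral_const_mul]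
    apply ENNReal.ofReal_le_ofReal
    have := one_add_sq_le_integral_norm_sq_circleMap hq h0 hs0 (hs.2.trans_lt hR)
    calc _ = (s ^ 2)⁻¹ * (2 * Real.pi * (1 + ‖deriv q 0‖ ^ 2 * s ^ 2)) := by field_simp
      _ ≤ _ := by gcongr
  have hne : ∀ s ∈ Set.uIcc r R, s ≠ 0 := fun s hs => by
    rw [Set.uIcc_of_le hrR.le] at hs; exact (hr.trans_le hs.1).ne'
  have hcon : ContinuousOn (fun s : ℝ => 2 * Real.pi * ((s ^ 2)⁻¹ + ‖deriv q 0‖ ^ 2))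
      (Set.uIcc r R) := by
    refine continuousOn_const.mul ((ContinuousOn.inv₀ (by fun_prop) ?_).add continuousOn_const)
    intro s hs; have := hne s hs; positivity
  calc _ = ∫⁻ s in Set.Icc r R,
          ENNReal.ofReal (2 * Real.pi * ((s ^ 2)⁻¹ + ‖deriv q 0‖ ^ 2)) := by
        rw [← ofReal_integral_eq_lintegral_ofReal
          (by rw [Set.uIcc_of_le hrR.le] at hcon; exact hcon.integrableOn_Icc)
          (Filter.Eventually.of_forall fun θ => by positivity),
          integral_Icc_eq_integral_Ioc, ← intervalIntegral.integral_of_le hrR.le]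
        congr 1
        rw [intervalIntegral.integral_eq_sub_of_hasDerivAt
          (f := fun s => 2 * Real.pi * (-s⁻¹ + ‖deriv q 0‖ ^ 2 * s)) _ hcon.intervalIntegrable]
        · ring
        · intro s hs
          have h1 := (hasDerivAt_inv (hne s hs)).neg.add
            ((hasDerivAt_id s).const_mul (‖deriv q 0‖ ^ 2))
          refine (h1.const_mul (2 * Real.pi)).congr_deriv ?_
          simp
    _ ≤ ∫⁻ s in Set.Icc r R, _ := setLIntegral_mono' measurableSet_Icc hinner
    _ ≤ _ := lintegral_mono_set fun s hs => hr.trans_le hs.1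

/-- For a normalised univalent function on the disk, the image of `{r ≤ ‖z‖}` lies outside
a conic with focus `0` that approximates the circle of radius `r`. -/
theorem exists_one_le_of_injOn {φ : ℂ → ℂ} (hφ : DifferentiableOn ℂ φ (ball 0 1))
    (h0 : φ 0 = 1) (hinj : Set.InjOn (fun z => z * φ z) (ball 0 1)) :
    ∃ C r₀ : ℝ, 0 < r₀ ∧ ∀ r, 0 < r → r < r₀ → ‖deriv φ 0‖ < r⁻¹ + C * r ∧
      ∀ z ∈ ball (0 : ℂ) 1, r ≤ ‖z‖ →
        1 ≤ (r⁻¹ + C * r) * ‖z * φ z‖ - (deriv φ 0 * (z * φ z)).re := by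
  set a := deriv φ 0 with ha
  have hn : ball (0 : ℂ) 1 ∈ nhds 0 := ball_mem_nhds _ one_pos
  have hd1 : DifferentiableOn ℂ (dslope φ 0) (ball 0 1) :=
    (Complex.differentiableOn_dslope hn).2 hφ
  set h := dslope (dslope φ 0) 0
  have hd2 : DifferentiableOn ℂ h (ball 0 1) := (Complex.differentiableOn_dslope hn).2 hd1
  have hexp : ∀ z, φ z = 1 + a * z + z ^ 2 * h z := by
    intro z
    have e1 := sub_smul_dslope φ 0 z
    have e2 := sub_smul_dslope (dslope φ 0) 0 z
    rw [dslope_same, ← ha] at e2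
    simp only [sub_zero, smul_eq_mul, h0] at e1 e2
    linear_combination -e1 - z * e2
  obtain ⟨M, hM⟩ := (isCompact_closedBall (0 : ℂ) (1 / 2)).exists_bound_of_continuousOn
    (hd2.continuousOn.mono (closedBall_subset_ball (by norm_num)))
  have hM0 : 0 ≤ M := (norm_nonneg _).trans (hM 0 (by simp))
  set f : ℂ → ℂ := fun z => z * φ z with hf
  have hfd : DifferentiableOn ℂ f (ball 0 1) := by fun_prop
  refine ⟨2 * (M + ‖a‖ ^ 2 + ‖a‖ * M), min (1 / 2) (1 / (2 * (‖a‖ + M + 1))), by positivity,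
    fun r hr hr0 => ?_⟩
  set C := 2 * (M + ‖a‖ ^ 2 + ‖a‖ * M) with hC
  have hC0 : 0 ≤ C := by positivity
  have hr1 : r < 1 / 2 := hr0.trans_le (min_le_left _ _)
  have hr2 : (‖a‖ + M + 1) * r < 1 / 2 := by
    have := hr0.trans_le (min_le_right _ _)
    rw [lt_div_iff₀ (by positivity)] at this
    linarith
  have har : ‖a‖ * r < 1 / 2 := by nlinarith [norm_nonneg a, mul_nonneg hM0 hr.le]
  have hκ : ‖a‖ < r⁻¹ + C * r := by
    have : ‖a‖ < r⁻¹ := by rw [← one_div, lt_div_iff₀ hr]; linarith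
    nlinarith [mul_nonneg hC0 hr.le]
  refine ⟨hκ, ?_⟩
  set κ := r⁻¹ + C * r with hκdef
  have hκ0 : 0 ≤ κ := (norm_nonneg a).trans hκ.le
  have hsphere : ∀ z : ℂ, ‖z‖ = r → 1 ≤ κ * ‖f z‖ - (a * f z).re := by
    intro z hz
    have hhz : ‖h z‖ ≤ M := hM z (by rw [mem_closedBall_zero_iff, hz]; exact hr1.le)
    have hz2 : ‖z ^ 2 * h z‖ ≤ M * r ^ 2 := by
      rw [norm_mul, norm_pow, hz]; nlinarith [sq_nonneg r]
    set x := (a * z).re with hx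
    have hxabs : |x| ≤ ‖a‖ * r := by
      rw [← hz, ← norm_mul]; exact Complex.abs_re_le_norm _
    have h1 : 1 + x - M * r ^ 2 ≤ ‖φ z‖ := by
      have e : 1 + x = (φ z - z ^ 2 * h z).re := by rw [hexp z]; simp [x]
      have := Complex.re_le_norm (φ z - z ^ 2 * h z)
      have := norm_sub_le (φ z) (z ^ 2 * h z)
      linarith
    have h2 : (a * f z).re ≤ x + (‖a‖ ^ 2 + ‖a‖ * M) * r ^ 2 := by
      have e : a * f z = a * z + a * z * (a * z + z ^ 2 * h z) := by
        simp only [hf]; rw [hexp z]; ring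
      rw [e, Complex.add_re]
      have h3 := Complex.re_le_norm (a * z * (a * z + z ^ 2 * h z))
      have h4 : ‖a * z * (a * z + z ^ 2 * h z)‖ ≤ (‖a‖ * r) * (‖a‖ * r + M * r ^ 2) := by
        rw [norm_mul, norm_mul, hz]
        gcongr
        refine (norm_add_le _ _).trans ?_
        rw [norm_mul, hz]
        gcongr
      have h5 : ‖a‖ * r * (M * r ^ 2) ≤ ‖a‖ * M * r ^ 2 := by
        have : r * (‖a‖ * M * r ^ 2) ≤ 1 * (‖a‖ * M * r ^ 2) := by
          gcongr; linarith
        linarith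
      linarith
    have h6 : 1 / 2 ≤ 1 + x - M * r ^ 2 := by
      have := (abs_le.1 hxabs).1
      have : M * r ^ 2 ≤ M * r := by nlinarith [mul_nonneg hM0 hr.le]
      nlinarith
    have h7 : ‖f z‖ = r * ‖φ z‖ := by simp [hf, hz]
    have h8 : κ * ‖f z‖ = (1 + C * r ^ 2) * ‖φ z‖ := by
      rw [h7, hκdef]; field_simp
    have h9 : (1 + C * r ^ 2) * (1 + x - M * r ^ 2) ≤ κ * ‖f z‖ := by
      rw [h8]; gcongr
    have h10 : C * r ^ 2 * (1 / 2) ≤ C * r ^ 2 * (1 + x - M * r ^ 2) := by gcongr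
    rw [hC] at h9 h10
    linarith
  set U := {w : ℂ | κ * ‖w‖ - (a * w).re < 1} with hU
  have hUconv : Convex ℝ U := by
    have h1 : ConvexOn ℝ Set.univ fun w : ℂ => κ * ‖w‖ - (a * w).re := by
      refine ConvexOn.sub ((convexOn_norm convex_univ).smul hκ0) ?_
      refine ⟨convex_univ, fun x _ y _ s t _ _ _ => le_of_eq ?_⟩
      simp [mul_add, mul_left_comm]
    simpa [hU] using h1.convex_lt 1
  have hfopen : IsOpen (f '' ball 0 r) := by
    have hsub : ball (0 : ℂ) r ⊆ ball 0 1 := ball_subset_ball (by linarith)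
    rcases (hfd.analyticOnNhd isOpen_ball).is_constant_or_isOpen
      (convex_ball (0 : ℂ) 1).isPreconnected with ⟨w, hw⟩ | ho
    · exfalso
      have h1 : (0 : ℂ) ∈ ball (0 : ℂ) 1 := mem_ball_self one_pos
      have h2 : (1 / 2 : ℂ) ∈ ball (0 : ℂ) 1 := by simp; norm_num
      have := hinj h1 h2 ((hw _ h1).trans (hw _ h2).symm)
      norm_num at this
    · exact ho _ hsub isOpen_ball
  have hsub1 : closedBall (0 : ℂ) r ⊆ ball 0 1 := closedBall_subset_ball (by linarith)
  have hcl : closure (f '' ball 0 r) ⊆ f '' closedBall 0 r :=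
    closure_minimal (Set.image_mono ball_subset_closedBall)
      ((isCompact_closedBall (0 : ℂ) r).image_of_continuousOn
        (hfd.continuousOn.mono hsub1)).isClosed
  have hUsub : U ⊆ f '' ball 0 r := by
    refine hUconv.isPreconnected.subset_of_closure_inter_subset hfopen
      ⟨0, by simp [hU], 0, by simpa using hr, by simp [hf]⟩ ?_
    rintro w ⟨hw, hwU⟩
    obtain ⟨z, hz, rfl⟩ := hcl hw
    refine ⟨z, ?_, rfl⟩
    rw [mem_closedBall_zero_iff] at hz
    rw [mem_ball_zero_iff]
    refine lt_of_le_of_ne hz fun hzr => ?_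
    exact absurd (hsphere z hzr) (not_le.2 hwU)
  intro z hz hrz
  by_contra hcon
  obtain ⟨w, hw, hwz⟩ := hUsub (show f z ∈ U from not_le.1 hcon)
  have := hinj (ball_subset_ball (by linarith) hw) hz hwz
  rw [mem_ball_zero_iff, this] at hw
  linarith

theorem abs_det_restrictScalars_toSpanSingleton (c : ℂ) :
    |((ContinuousLinearMap.toSpanSingleton ℂ c).restrictScalars ℝ).det| = ‖c‖ ^ 2 := by
  simp [ContinuousLinearMap.det, LinearMap.det_restrictScalars, Algebra.norm_complex_eq,
    Complex.normSq_eq_norm_sq]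

open MeasureTheory Filter Topology in
/-- **Bieberbach's inequality** for the second coefficient of the univalent map `z ↦ z * φ z`. -/
theorem norm_deriv_le_two_of_injOn {φ : ℂ → ℂ} (hφ : DifferentiableOn ℂ φ (ball 0 1))
    (h0 : φ 0 = 1) (hinj : Set.InjOn (fun z => z * φ z) (ball 0 1)) : ‖deriv φ 0‖ ≤ 2 := by
  have hm0 : (0 : ℂ) ∈ ball (0 : ℂ) 1 := mem_ball_self one_pos
  have hne : ∀ z ∈ ball (0 : ℂ) 1, φ z ≠ 0 := by
    intro z hz hz0
    have : z = 0 := hinj hz hm0 (by simp [hz0])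
    rw [this, h0] at hz0
    exact one_ne_zero hz0
  obtain ⟨E, hE, hE0, hEφ⟩ := exists_sq_mul_eq_one hφ h0 hne
  have hφ' : DifferentiableOn ℂ (deriv φ) (ball 0 1) := hφ.deriv isOpen_ball
  set a := deriv φ 0 with ha
  set q : ℂ → ℂ := fun z => (φ z + z * deriv φ z) * E z ^ 3 with hq
  have hqd : DifferentiableOn ℂ q (ball 0 1) := by fun_prop
  have hq0 : q 0 = 1 := by simp [hq, h0, hE0]
  have hat : ∀ {g : ℂ → ℂ}, DifferentiableOn ℂ g (ball 0 1) → ∀ z ∈ ball (0 : ℂ) 1,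
      HasDerivAt g (deriv g z) z := fun hg z hz =>
    (hg.differentiableAt (isOpen_ball.mem_nhds hz)).hasDerivAt
  have hE' : 2 * deriv E 0 + a = 0 := by
    have h1 := ((hat hE 0 hm0).pow 2).mul (hat hφ 0 hm0)
    have h2 : HasDerivAt (E ^ 2 * φ) 0 0 :=
      (hasDerivAt_const (0 : ℂ) (1 : ℂ)).congr_of_eventuallyEq
        (eventually_of_mem (isOpen_ball.mem_nhds hm0) hEφ)
    have h3 := h1.unique h2
    simpa [hE0, h0, ← ha] using h3
  have hq' : deriv q 0 = a / 2 := by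
    have h1 := ((hat hφ 0 hm0).add ((hasDerivAt_id (0 : ℂ)).mul (hat hφ' 0 hm0))).mul
      ((hat hE 0 hm0).pow 3)
    have h2 : deriv q 0 = _ := h1.deriv
    rw [h2]
    simp only [id, Pi.pow_apply, Pi.add_apply, Pi.mul_apply, hE0, h0, ← ha]
    push_cast
    linear_combination (3 / 2 : ℂ) * hE'
  obtain ⟨C, r₀, hr₀, hC⟩ := exists_one_le_of_injOn hφ h0 hinj
  have key : ∀ R, 0 < R → R < 1 → ∀ r, 0 < r → r < r₀ → r < R →
      ‖a / 2‖ ^ 2 * (R - r) ≤ R⁻¹ + C * r := by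
    intro R hR hR1 r hr hr0 hrR
    obtain ⟨hκ, hK⟩ := hC r hr hr0
    set A := {z : ℂ | r ≤ ‖z‖ ∧ ‖z‖ ≤ R}
    have hA : MeasurableSet A :=
      (measurableSet_le measurable_const measurable_norm).inter
        (measurableSet_le measurable_norm measurable_const)
    have hAsub : A ⊆ ball 0 1 := fun z hz => by
      rw [mem_ball_zero_iff]; exact hz.2.trans_lt hR1
    have hder : ∀ z ∈ A, HasFDerivWithinAt (fun z => z * φ z)
        ((ContinuousLinearMap.toSpanSingleton ℂ (φ z + z * deriv φ z)).restrictScalars ℝ) A z := by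
      intro z hz
      have h1 := (hasDerivAt_id z).mul (hat hφ z (hAsub hz))
      simp only [id, one_mul] at h1
      exact (h1.hasFDerivAt.restrictScalars ℝ).hasFDerivWithinAt
    have h1 := le_lintegral_annulus_norm_sq hqd hq0 hr hrR hR1
    have h2 := lintegral_inv_norm_cube_conic hκ
    have h3 := lintegral_image_eq_lintegral_abs_det_fderiv_mul volume hA hder
      (hinj.mono hAsub) (fun w => ENNReal.ofReal (1 / ‖w‖ ^ 3))
    have h4 : ∫⁻ z in A, ENNReal.ofReal (‖q z‖ ^ 2 / ‖z‖ ^ 3) =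
        ∫⁻ z in A, ENNReal.ofReal
          |((ContinuousLinearMap.toSpanSingleton ℂ
            (φ z + z * deriv φ z)).restrictScalars ℝ).det| *
              ENNReal.ofReal (1 / ‖z * φ z‖ ^ 3) := by
      refine setLIntegral_congr_fun hA fun z hz => ?_
      have hzpos : 0 < ‖z‖ := hr.trans_le hz.1
      have hφpos : 0 < ‖φ z‖ := norm_pos_iff.2 (hne z (hAsub hz))
      have e : ‖E z‖ ^ 2 = ‖φ z‖⁻¹ := by
        apply eq_inv_of_mul_eq_one_left
        rw [← norm_pow, ← norm_mul, hEφ z (hAsub hz), norm_one]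
      simp only [abs_det_restrictScalars_toSpanSingleton]
      rw [← ENNReal.ofReal_mul (by positivity)]
      congr 1
      simp only [hq, norm_mul, norm_pow]
      rw [show (‖φ z + z * deriv φ z‖ * ‖E z‖ ^ 3) ^ 2 =
        ‖φ z + z * deriv φ z‖ ^ 2 * (‖E z‖ ^ 2) ^ 3 by ring, e]
      field_simp
    have h5 : (fun z => z * φ z) '' A ⊆
        {w : ℂ | 1 ≤ (r⁻¹ + C * r) * ‖w‖ - (a * w).re} := by
      rintro _ ⟨z, hz, rfl⟩
      exact hK z (hAsub hz) hz.1
    have h6 := h1.trans (h4.le.trans (h3.symm.le.trans ((lintegral_mono_set h5).trans h2.le)))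
    have hκ0 : 0 ≤ r⁻¹ + C * r := (norm_nonneg _).trans hκ.le
    rw [ENNReal.ofReal_le_ofReal_iff (by positivity), hq'] at h6
    have h7 := le_of_mul_le_mul_left h6 (by positivity)
    linarith
  have key2 : ∀ R, 0 < R → R < 1 → ‖a / 2‖ ^ 2 * R ≤ R⁻¹ := by
    intro R hR hR1
    have hl : Tendsto (fun r : ℝ => ‖a / 2‖ ^ 2 * (R - r)) (𝓝[>] 0)
        (𝓝 (‖a / 2‖ ^ 2 * (R - 0))) :=
      ((by fun_prop : Continuous fun r : ℝ => ‖a / 2‖ ^ 2 * (R - r)).tendsto 0).mono_left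
        nhdsWithin_le_nhds
    have hr : Tendsto (fun r : ℝ => R⁻¹ + C * r) (𝓝[>] 0) (𝓝 (R⁻¹ + C * 0)) :=
      ((by fun_prop : Continuous fun r : ℝ => R⁻¹ + C * r).tendsto 0).mono_left
        nhdsWithin_le_nhds
    have := le_of_tendsto_of_tendsto hl hr (by
      filter_upwards [Ioo_mem_nhdsGT (lt_min hr₀ hR)] with r hr
      exact key R hR hR1 r hr.1 (hr.2.trans_le (min_le_left _ _))
        (hr.2.trans_le (min_le_right _ _)))
    simpa using this
  have key3 : ‖a / 2‖ ^ 2 ≤ 1 := by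
    have hl : Tendsto (fun R : ℝ => ‖a / 2‖ ^ 2 * R) (𝓝[<] 1) (𝓝 (‖a / 2‖ ^ 2 * 1)) :=
      ((by fun_prop : Continuous fun R : ℝ => ‖a / 2‖ ^ 2 * R).tendsto 1).mono_left
        nhdsWithin_le_nhds
    have hr : Tendsto (fun R : ℝ => R⁻¹) (𝓝[<] 1) (𝓝 (1 : ℝ)⁻¹) :=
      (tendsto_inv₀ (one_ne_zero)).mono_left nhdsWithin_le_nhds
    have := le_of_tendsto_of_tendsto hl hr (by
      filter_upwards [Ioo_mem_nhdsLT (zero_lt_one (α := ℝ))] with R hR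
      exact key2 R hR.1 hR.2)
    simpa using this
  rw [norm_div] at key3
  have : ‖a‖ / ‖(2 : ℂ)‖ ≤ 1 := by
    rw [sq_le_one_iff_abs_le_one] at key3
    exact (le_abs_self _).trans key3
  norm_num at this
  linarith

open Filter Topology in
theorem deriv_deriv_eq_two_mul_deriv_dslope {g : ℂ → ℂ} {ρ : ℝ} (hρ : 0 < ρ)
    (hg : DifferentiableOn ℂ g (ball 0 ρ)) : deriv (deriv g) 0 = 2 * deriv (dslope g 0) 0 := by
  have hn : ball (0 : ℂ) ρ ∈ 𝓝 0 := ball_mem_nhds _ hρ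
  set D := dslope g 0 with hD
  have hd : DifferentiableOn ℂ D (ball 0 ρ) := (Complex.differentiableOn_dslope hn).2 hg
  have hd' : DifferentiableOn ℂ (deriv D) (ball 0 ρ) := hd.deriv isOpen_ball
  have hgD : g = fun z => g 0 + z * D z := by
    ext z
    have := sub_smul_dslope g 0 z
    simp only [sub_zero, smul_eq_mul] at this
    rw [hD, this]; ring
  have hev : deriv g =ᶠ[𝓝 0] fun z => D z + z * deriv D z := by
    filter_upwards [hn] with z hz
    have h1 := (((hasDerivAt_id z).mul
      (hd.differentiableAt (isOpen_ball.mem_nhds hz)).hasDerivAt).const_add (g 0)).deriv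
    rw [hgD]
    simpa using h1
  rw [hev.deriv_eq]
  have h2 := ((hd.differentiableAt hn).hasDerivAt.add ((hasDerivAt_id (0 : ℂ)).mul
    (hd'.differentiableAt hn).hasDerivAt)).deriv
  refine h2.trans ?_
  simp; ring

theorem norm_deriv_deriv_div_mul_le_four {g : ℂ → ℂ} {ρ : ℝ} (hρ : 0 < ρ)
    (hg : DifferentiableOn ℂ g (ball 0 ρ)) (hinj : Set.InjOn g (ball 0 ρ))
    (hg0 : deriv g 0 ≠ 0) : ‖deriv (deriv g) 0 / deriv g 0‖ * ρ ≤ 4 := by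
  have hn : ball (0 : ℂ) ρ ∈ nhds 0 := ball_mem_nhds _ hρ
  have hρ' : (ρ : ℂ) ≠ 0 := by exact_mod_cast hρ.ne'
  have hd : DifferentiableOn ℂ (dslope g 0) (ball 0 ρ) := (Complex.differentiableOn_dslope hn).2 hg
  have hmap : Set.MapsTo (fun z : ℂ => ρ * z) (ball 0 1) (ball 0 ρ) := fun z hz => by
    rw [mem_ball_zero_iff] at hz ⊢
    rw [norm_mul, Complex.norm_real, Real.norm_of_nonneg hρ.le]
    nlinarith
  have hφd : DifferentiableOn ℂ (fun z => dslope g 0 (ρ * z) / deriv g 0) (ball 0 1) :=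
    (hd.comp (by fun_prop) hmap).div_const _
  have key := norm_deriv_le_two_of_injOn hφd (by simp [hg0]) (by
    intro z hz w hw hzw
    have e : ∀ z : ℂ, z * (dslope g 0 (ρ * z) / deriv g 0) =
        (g (ρ * z) - g 0) / (ρ * deriv g 0) := by
      intro z
      have := sub_smul_dslope g 0 (ρ * z)
      simp only [sub_zero, smul_eq_mul] at this
      rw [← this]; field_simp
    simp only [e] at hzw
    have h1 : g (ρ * z) = g (ρ * w) := by
      rw [div_left_inj' (mul_ne_zero hρ' hg0)] at hzw
      exact sub_left_injective hzw
    exact mul_left_cancel₀ hρ' (hinj (hmap hz) (hmap hw) h1))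
  have h1 : deriv (fun z => dslope g 0 (ρ * z) / deriv g 0) 0 =
      deriv (deriv g) 0 / deriv g 0 * ρ / 2 := by
    rw [deriv_div_const, deriv_comp_mul_left, mul_zero, smul_eq_mul,
      deriv_deriv_eq_two_mul_deriv_dslope hρ hg]
    ring
  rw [h1, norm_div, norm_mul, Complex.norm_real, Real.norm_of_nonneg hρ.le] at key
  norm_num at key ⊢
  linarith

theorem one_sub_mul_ne_zero_of_mem_ball {a b : ℂ} (ha : a ∈ ball (0 : ℂ) 1)
    (hb : b ∈ ball (0 : ℂ) 1) : 1 - a * b ≠ 0 := by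
  intro h
  rw [mem_ball_zero_iff] at ha hb
  have h1 : ‖a * b‖ = 1 := by rw [← sub_eq_zero.1 h, norm_one]
  rw [norm_mul] at h1
  nlinarith [norm_nonneg a, norm_nonneg b]

theorem one_add_conj_mul_ne_zero_of_mem_ball {z w : ℂ} (hz : z ∈ ball (0 : ℂ) 1)
    (hw : w ∈ ball (0 : ℂ) 1) : 1 + (starRingEnd ℂ) z * w ≠ 0 := by
  have hz' : -(starRingEnd ℂ) z ∈ ball (0 : ℂ) 1 := by simpa using hz
  have := one_sub_mul_ne_zero_of_mem_ball hz' hw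
  simpa using this

theorem norm_conj_sub_le_norm_one_sub_mul {z v : ℂ} (hz : z ∈ ball (0 : ℂ) 1)
    (hv : v ∈ ball (0 : ℂ) 1) : ‖(starRingEnd ℂ) z - v‖ ≤ ‖1 - z * v‖ := by
  rw [mem_ball_zero_iff] at hz hv
  have e : ‖1 - z * v‖ ^ 2 - ‖(starRingEnd ℂ) z - v‖ ^ 2 = (1 - ‖z‖ ^ 2) * (1 - ‖v‖ ^ 2) := by
    simp only [← Complex.normSq_eq_norm_sq, Complex.normSq_apply, Complex.sub_re, Complex.sub_im,
      Complex.mul_re, Complex.mul_im, Complex.one_re, Complex.one_im, Complex.conj_re,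
      Complex.conj_im]
    ring
  have h : 0 ≤ (1 - ‖z‖ ^ 2) * (1 - ‖v‖ ^ 2) := by
    apply mul_nonneg <;> nlinarith [norm_nonneg z, norm_nonneg v]
  exact (sq_le_sq₀ (norm_nonneg _) (norm_nonneg _)).1 (by linarith)

theorem mobius_mem_ball {z w : ℂ} (hz : z ∈ ball (0 : ℂ) 1) (hw : w ∈ ball (0 : ℂ) 1) :
    (w + z) / (1 + (starRingEnd ℂ) z * w) ∈ ball (0 : ℂ) 1 := by
  have hne := one_add_conj_mul_ne_zero_of_mem_ball hz hw
  rw [mem_ball_zero_iff] at hz hw ⊢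
  rw [norm_div, div_lt_one (norm_pos_iff.2 hne)]
  have e : ‖1 + (starRingEnd ℂ) z * w‖ ^ 2 - ‖w + z‖ ^ 2 = (1 - ‖z‖ ^ 2) * (1 - ‖w‖ ^ 2) := by
    simp only [← Complex.normSq_eq_norm_sq, Complex.normSq_apply, Complex.add_re, Complex.add_im,
      Complex.mul_re, Complex.mul_im, Complex.one_re, Complex.one_im, Complex.conj_re,
      Complex.conj_im]
    ring
  have h : 0 < (1 - ‖z‖ ^ 2) * (1 - ‖w‖ ^ 2) := by
    apply mul_pos <;> nlinarith [norm_nonneg z, norm_nonneg w]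
  exact lt_of_pow_lt_pow_left₀ 2 (norm_nonneg _) (by linarith)

theorem hasDerivAt_mobius {z w : ℂ} (hz : z ∈ ball (0 : ℂ) 1) (hw : w ∈ ball (0 : ℂ) 1) :
    HasDerivAt (fun w => (w + z) / (1 + (starRingEnd ℂ) z * w))
      ((1 - (starRingEnd ℂ) z * z) / (1 + (starRingEnd ℂ) z * w) ^ 2) w := by
  have hne := one_add_conj_mul_ne_zero_of_mem_ball hz hw
  have h := ((hasDerivAt_id w).add_const z).div
    (((hasDerivAt_id w).const_mul ((starRingEnd ℂ) z)).const_add 1) hne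
  refine h.congr_deriv ?_
  simp only [id]
  congr 1
  ring

theorem HasStrictDerivAt.exists_injOn_ball {f : ℂ → ℂ} {f' a : ℂ} (hf : HasStrictDerivAt f f' a)
    (hf' : f' ≠ 0) : ∃ ε > 0, Set.InjOn f (ball a ε) := by
  have h := (hf.hasStrictFDerivAt_equiv hf').eventually_left_inverse
  obtain ⟨ε, hε, hb⟩ := Metric.eventually_nhds_iff_ball.1 h
  exact ⟨ε, hε, Set.LeftInvOn.injOn hb⟩

open Filter Topology in
theorem mul_norm_deriv_mirrorDsq_div_le {ψ : ℂ → ℂ} {z v b c : ℂ}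
    (hψ : DifferentiableOn ℂ ψ (ball (0 : ℂ) 1))
    (hmap : ∀ z ∈ ball (0 : ℂ) 1, ψ z ∈ ball (0 : ℂ) 1)
    (hcrit : ∀ z ∈ ball (0 : ℂ) 1, deriv ψ z ≠ 0)
    (hz : z ∈ ball (0 : ℂ) 1) (hv : v ∈ ball (0 : ℂ) 1) (hb : b ∈ ball (0 : ℂ) 1) (hc : c ≠ 0) :
    (1 - ‖z‖ ^ 2) * ‖deriv (fun w => deriv ψ w * c * (1 - w * v) ^ 2 / (1 - ψ w * b) ^ 2) z /
      (deriv ψ z * c * (1 - z * v) ^ 2 / (1 - ψ z * b) ^ 2)‖ ≤ 2 + 4 / injRad ψ z := by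
  set R : ℂ → ℂ := fun w => (w + z) / (1 + (starRingEnd ℂ) z * w) with hR
  set P : ℂ → ℂ := fun w => deriv ψ w / (1 - ψ w * b) ^ 2 with hP
  have hm0 : (0 : ℂ) ∈ ball (0 : ℂ) 1 := mem_ball_self one_pos
  have hn : ball (0 : ℂ) 1 ∈ 𝓝 0 := ball_mem_nhds _ one_pos
  have hψ' : DifferentiableOn ℂ (deriv ψ) (ball 0 1) := hψ.deriv isOpen_ball
  have hden : ∀ w ∈ ball (0 : ℂ) 1, 1 - ψ w * b ≠ 0 := fun w hw =>
    one_sub_mul_ne_zero_of_mem_ball (hmap w hw) hb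
  have hPd : DifferentiableOn ℂ P (ball 0 1) :=
    hψ'.div (by fun_prop) fun w hw => pow_ne_zero 2 (hden w hw)
  have hPz : P z ≠ 0 := div_ne_zero (hcrit z hz) (pow_ne_zero 2 (hden z hz))
  have hPat : HasDerivAt P (deriv P z) z :=
    (hPd.differentiableAt (isOpen_ball.mem_nhds hz)).hasDerivAt
  have hR0 : R 0 = z := by simp [hR]
  have hRmem : Set.MapsTo R (ball 0 1) (ball 0 1) := fun w hw => mobius_mem_ball hz hw
  have hRder : ∀ w ∈ ball (0 : ℂ) 1, HasDerivAt R
      ((1 - (starRingEnd ℂ) z * z) / (1 + (starRingEnd ℂ) z * w) ^ 2) w := fun w hw =>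
    hasDerivAt_mobius hz hw
  have hRd : DifferentiableOn ℂ R (ball 0 1) := fun w hw =>
    (hRder w hw).differentiableAt.differentiableWithinAt
  have hzn : (starRingEnd ℂ) z * z = ((‖z‖ ^ 2 : ℝ) : ℂ) := by
    rw [mul_comm, Complex.mul_conj, Complex.normSq_eq_norm_sq]
  have hδ : 0 < 1 - ‖z‖ ^ 2 := by
    rw [mem_ball_zero_iff] at hz; nlinarith [norm_nonneg z]
  set δ : ℂ := 1 - (starRingEnd ℂ) z * z with hδdef
  have hδn : δ = ((1 - ‖z‖ ^ 2 : ℝ) : ℂ) := by rw [hδdef, hzn]; push_cast; ring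
  have hδ0 : δ ≠ 0 := by rw [hδn]; exact_mod_cast hδ.ne'
  set g : ℂ → ℂ := fun w => ψ (R w) / (1 - ψ (R w) * b) with hg
  have hgder : ∀ w ∈ ball (0 : ℂ) 1,
      HasDerivAt g (P (R w) * (δ / (1 + (starRingEnd ℂ) z * w) ^ 2)) w := by
    intro w hw
    have h1 : HasDerivAt (fun w => ψ (R w)) _ w :=
      (hψ.differentiableAt (isOpen_ball.mem_nhds (hRmem hw))).hasDerivAt.comp w (hRder w hw)
    have h2 := h1.div ((h1.mul_const b).const_sub 1) (hden _ (hRmem hw))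
    refine h2.congr_deriv ?_
    simp only [hP]
    have := hden _ (hRmem hw)
    field_simp
    ring
  have hgd : DifferentiableOn ℂ g (ball 0 1) := fun w hw =>
    (hgder w hw).differentiableAt.differentiableWithinAt
  have hg0 : deriv g 0 = P z * δ := by rw [(hgder 0 hm0).deriv, hR0]; simp
  have hg0' : deriv g 0 ≠ 0 := by rw [hg0]; exact mul_ne_zero hPz hδ0
  have hg2 : deriv (deriv g) 0 = deriv P z * δ ^ 2 - 2 * (starRingEnd ℂ) z * δ * P z := by
    have hev : deriv g =ᶠ[𝓝 0] fun w => P (R w) * (δ / (1 + (starRingEnd ℂ) z * w) ^ 2) :=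
      eventually_of_mem hn fun w hw => (hgder w hw).deriv
    rw [hev.deriv_eq]
    have h1 : HasDerivAt (fun w => P (R w)) (deriv P z * δ) 0 := by
      have := HasDerivAt.comp (0 : ℂ) (h₂ := P) (by rw [hR0]; exact hPat) (hRder 0 hm0)
      simpa [Function.comp_def] using this
    have h2 : HasDerivAt (fun w => δ / (1 + (starRingEnd ℂ) z * w) ^ 2)
        (-2 * (starRingEnd ℂ) z * δ) 0 := by
      have := (hasDerivAt_const (0 : ℂ) δ).div
        ((((hasDerivAt_id (0 : ℂ)).const_mul ((starRingEnd ℂ) z)).const_add 1).pow 2) (by simp)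
      refine this.congr_deriv ?_
      simp; ring
    have h3 := (h1.mul h2).deriv
    refine h3.trans ?_
    simp [hR0]; ring
  have hX : ∀ ρ : ℝ, 0 < ρ → ρ ≤ 1 → Set.InjOn (fun w => ψ (R w)) (ball 0 ρ) →
      ‖deriv (deriv g) 0 / deriv g 0‖ * ρ ≤ 4 := by
    intro ρ hρ hρ1 hinj
    have hsub : ball (0 : ℂ) ρ ⊆ ball 0 1 := ball_subset_ball hρ1
    refine norm_deriv_deriv_div_mul_le_four hρ (hgd.mono hsub) (fun x hx y hy hxy => ?_) hg0'
    refine hinj hx hy ?_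
    have hx' := hden _ (hRmem (hsub hx))
    have hy' := hden _ (hRmem (hsub hy))
    simp only [hg] at hxy
    rw [div_eq_div_iff hx' hy'] at hxy
    linear_combination hxy
  have hbound : ‖deriv (deriv g) 0 / deriv g 0‖ ≤ 4 / injRad ψ z := by
    have hbdd : BddAbove {ρ : ℝ | 0 < ρ ∧ ρ ≤ 1 ∧ Set.InjOn (fun w => ψ (R w)) (ball (0 : ℂ) ρ)} :=
      ⟨1, fun ρ hρ => hρ.2.1⟩
    obtain ⟨ε, hε, hinj⟩ : ∃ ε > 0, Set.InjOn (fun w => ψ (R w)) (ball 0 ε) := by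
      have hd : DifferentiableOn ℂ (fun w => ψ (R w)) (ball 0 1) := hψ.comp hRd hRmem
      have h1 : HasDerivAt (fun w => ψ (R w)) (deriv ψ z * δ) 0 := by
        have := HasDerivAt.comp (0 : ℂ) (h₂ := ψ)
          (by rw [hR0]; exact (hψ.differentiableAt (isOpen_ball.mem_nhds hz)).hasDerivAt)
          (hRder 0 hm0)
        simpa [Function.comp_def] using this
      have h2 := (hd.analyticAt hn).hasStrictDerivAt
      rw [h1.deriv] at h2
      exact h2.exists_injOn_ball (mul_ne_zero (hcrit z hz) hδ0)
    have hmem : min ε 1 ∈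
        {ρ : ℝ | 0 < ρ ∧ ρ ≤ 1 ∧ Set.InjOn (fun w => ψ (R w)) (ball (0 : ℂ) ρ)} :=
      ⟨lt_min hε one_pos, min_le_right _ _,
        hinj.mono (ball_subset_ball (min_le_left _ _))⟩
    have hpos : 0 < injRad ψ z := (lt_min hε one_pos).trans_le (le_csSup hbdd hmem)
    rw [le_div_iff₀ hpos]
    rcases (norm_nonneg (deriv (deriv g) 0 / deriv g 0)).eq_or_lt with h | h
    · rw [← h]; norm_num
    · rw [mul_comm, ← le_div_iff₀ h]
      refine csSup_le ⟨_, hmem⟩ fun ρ hρ => ?_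
      rw [le_div_iff₀ h, mul_comm]
      exact hX ρ hρ.1 hρ.2.1 hρ.2.2
  have hzv : 1 - z * v ≠ 0 := one_sub_mul_ne_zero_of_mem_ball hz hv
  have hfun : (fun w => deriv ψ w * c * (1 - w * v) ^ 2 / (1 - ψ w * b) ^ 2) =
      fun w => P w * (c * (1 - w * v) ^ 2) := by
    ext w; simp only [hP]; ring
  have hval : deriv ψ z * c * (1 - z * v) ^ 2 / (1 - ψ z * b) ^ 2 =
      P z * (c * (1 - z * v) ^ 2) := by simp only [hP]; ring
  have hlog : deriv (fun w => P w * (c * (1 - w * v) ^ 2)) z =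
      deriv P z * (c * (1 - z * v) ^ 2) + P z * (c * (-2 * v * (1 - z * v))) := by
    have h1 := (hPat.mul (((((hasDerivAt_id z).mul_const v).const_sub 1).pow 2).const_mul c)).deriv
    refine h1.trans ?_
    simp only [Pi.pow_apply, id]
    push_cast
    ring
  have hsplit : δ * (deriv (fun w => P w * (c * (1 - w * v) ^ 2)) z /
      (P z * (c * (1 - z * v) ^ 2))) =
      deriv (deriv g) 0 / deriv g 0 + 2 * (((starRingEnd ℂ) z - v) / (1 - z * v)) := by
    rw [hlog, hg2, hg0]
    field_simp
    rw [hδdef]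
    ring
  rw [hfun, hval]
  have hnorm : (1 - ‖z‖ ^ 2) = ‖δ‖ := by
    rw [hδn, Complex.norm_real, Real.norm_of_nonneg hδ.le]
  rw [hnorm, ← norm_mul, hsplit]
  refine (norm_add_le _ _).trans ?_
  have h5 : ‖2 * (((starRingEnd ℂ) z - v) / (1 - z * v))‖ ≤ 2 := by
    rw [norm_mul, norm_div, Complex.norm_ofNat]
    have := div_le_one_of_le₀ (norm_conj_sub_le_norm_one_sub_mul hz hv) (norm_nonneg _)
    linarith
  linarith

/-- **Mirror Koebe distortion.** For holomorphic maps `ψ₁, ψ₂ : 𝔻 → 𝔻` without critical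
points and `Ψ = (ψ₁,ψ₂)`, at every `(z₁,z₂) ∈ 𝔻²`:
`(1−|z_i|²)·|∂_{z_i} DΨ²/DΨ²| ≤ 2 + 4/ρ_i` where `ρ_i` is the Euclidean radius of
injectivity of `ψ_i` at `z_i`. -/
theorem mirror_koebe_distortion
    (ψ₁ ψ₂ : ℂ → ℂ)
    (hψ₁ : DifferentiableOn ℂ ψ₁ (ball (0 : ℂ) 1))
    (hψ₂ : DifferentiableOn ℂ ψ₂ (ball (0 : ℂ) 1))
    (hmap₁ : ∀ z ∈ ball (0 : ℂ) 1, ψ₁ z ∈ ball (0 : ℂ) 1)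
    (hmap₂ : ∀ z ∈ ball (0 : ℂ) 1, ψ₂ z ∈ ball (0 : ℂ) 1)
    (hcrit₁ : ∀ z ∈ ball (0 : ℂ) 1, deriv ψ₁ z ≠ 0)
    (hcrit₂ : ∀ z ∈ ball (0 : ℂ) 1, deriv ψ₂ z ≠ 0) :
    ∀ z₁ ∈ ball (0 : ℂ) 1, ∀ z₂ ∈ ball (0 : ℂ) 1,
      (1 - ‖z₁‖ ^ 2) *
          ‖deriv (fun w => mirrorDsq ψ₁ ψ₂ w z₂) z₁ /
            mirrorDsq ψ₁ ψ₂ z₁ z₂‖ ≤ 2 + 4 / injRad ψ₁ z₁ ∧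
      (1 - ‖z₂‖ ^ 2) *
          ‖deriv (fun w => mirrorDsq ψ₁ ψ₂ z₁ w) z₂ /
            mirrorDsq ψ₁ ψ₂ z₁ z₂‖ ≤ 2 + 4 / injRad ψ₂ z₂ := by
  intro z₁ hz₁ z₂ hz₂
  refine ⟨mul_norm_deriv_mirrorDsq_div_le hψ₁ hmap₁ hcrit₁ hz₁ hz₂ (hmap₂ z₂ hz₂)
    (hcrit₂ z₂ hz₂), ?_⟩
  have hsymm : ∀ w, mirrorDsq ψ₁ ψ₂ z₁ w = mirrorDsq ψ₂ ψ₁ w z₁ := fun w => by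
    simp only [mirrorDsq, mul_comm]
  simp only [hsymm]
  exact mul_norm_deriv_mirrorDsq_div_le hψ₂ hmap₂ hcrit₂ hz₂ hz₁ (hmap₁ z₁ hz₁) (hcrit₁ z₁ hz₁)

end
end
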